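/- Let K : ℝ → ℝ be continuous and without conjugate points, for r > 0 let J^r be the unique solution of the Jacobi equation with J^r(0) = 1 and J^r(r) = 0, and let J^{+∞} be the solution with J^{+∞}(0) = 1 and (J^{+∞})'(0) = lim_{r→+∞} (J^r)'(0) (this limit exists). Then for every t ∈ ℝ one has J^{+∞}(t) = lim_{r→+∞} J^r(t). -/

import Mathlib

open Set MeasureTheory Filter

/-- A solution of the scalar Jacobi equation `J'' + K·J = 0`. -/
def IsJacobiSolution (K J : ℝ → ℝ) : Prop :=
  ContDiff ℝ 2 J ∧ ∀ t : ℝ, deriv (deriv J) t + K t * J t = 0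

/-- `K` is without conjugate points: any solution vanishing at two distinct
points vanishes identically. -/
def WithoutConjugatePoints (K : ℝ → ℝ) : Prop :=
  ∀ J : ℝ → ℝ, IsJacobiSolution K J →
    ∀ a b : ℝ, a ≠ b → J a = 0 → J b = 0 → ∀ t : ℝ, J t = 0

namespace IsJacobiSolution

variable {K u v : ℝ → ℝ}

lemma differentiable (hu : IsJacobiSolution K u) : Differentiable ℝ u :=
  hu.1.differentiable (by norm_num)

lemma differentiable_deriv (hu : IsJacobiSolution K u) : Differentiable ℝ (deriv u) :=
  ((contDiff_succ_iff_deriv (n := 1)).1 (by simpa [one_add_one_eq_two] using hu.1)).2.2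
    |>.differentiable (by norm_num)

lemma hasDerivAt (hu : IsJacobiSolution K u) (t : ℝ) : HasDerivAt u (deriv u t) t :=
  (hu.differentiable t).hasDerivAt

lemma hasDerivAt_deriv (hu : IsJacobiSolution K u) (t : ℝ) :
    HasDerivAt (deriv u) (-(K t * u t)) t := by
  have h := (hu.differentiable_deriv t).hasDerivAt
  rwa [eq_neg_of_add_eq_zero_left (hu.2 t)] at h

lemma deriv_linear_comb (hu : IsJacobiSolution K u) (hv : IsJacobiSolution K v) (a b : ℝ) :
    deriv (fun t => a * u t + b * v t) = fun t => a * deriv u t + b * deriv v t :=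
  funext fun t => (((hu.hasDerivAt t).const_mul a).add ((hv.hasDerivAt t).const_mul b)).deriv

lemma linear_comb (hu : IsJacobiSolution K u) (hv : IsJacobiSolution K v) (a b : ℝ) :
    IsJacobiSolution K (fun t => a * u t + b * v t) := by
  refine ⟨(contDiff_const.mul hu.1).add (contDiff_const.mul hv.1), fun t => ?_⟩
  have h : deriv (fun t => a * deriv u t + b * deriv v t) t = _ :=
    (((hu.hasDerivAt_deriv t).const_mul a).add ((hv.hasDerivAt_deriv t).const_mul b)).deriv
  rw [hu.deriv_linear_comb hv, h]
  ring

lemma wronskian_eq (hu : IsJacobiSolution K u) (hv : IsJacobiSolution K v) (s t : ℝ) :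
    u s * deriv v s - deriv u s * v s = u t * deriv v t - deriv u t * v t := by
  have h (x : ℝ) : HasDerivAt (fun y => u y * deriv v y - deriv u y * v y) 0 x := by
    refine (((hu.hasDerivAt x).mul (hv.hasDerivAt_deriv x)).sub
      ((hu.hasDerivAt_deriv x).mul (hv.hasDerivAt x))).congr_deriv ?_
    ring
  exact is_const_of_deriv_eq_zero (fun x => (h x).differentiableAt) (fun x => (h x).deriv) s t

/-- A solution with vanishing Cauchy data at a point where another solution is nonzero
vanishes identically, in the absence of conjugate points. -/
lemma eq_zero_of_deriv_eq_zero (hK : WithoutConjugatePoints K) (hu : IsJacobiSolution K u)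
    (hv : IsJacobiSolution K v) {a : ℝ} (hua : u a ≠ 0) (hva : v a = 0) (hva' : deriv v a = 0)
    (t : ℝ) : v t = 0 := by
  obtain ⟨ε, hε, hball⟩ := Metric.eventually_nhds_iff_ball.1
    (hu.differentiable.continuous.continuousAt.eventually_ne hua)
  have hderiv : ∀ x ∈ Metric.ball a ε, HasDerivAt (fun y => v y / u y) 0 x := fun x hx => by
    have hW := hu.wronskian_eq hv x a
    rw [hva, hva', mul_zero, mul_zero, sub_zero] at hW
    refine ((hv.hasDerivAt x).div (hu.hasDerivAt x) (hball x hx)).congr_deriv ?_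
    rw [div_eq_zero_iff]
    left
    linarith
  have hmem : a + ε / 2 ∈ Metric.ball a ε := by
    rw [Metric.mem_ball, Real.dist_eq, add_sub_cancel_left, abs_of_pos (by linarith)]
    linarith
  have hconst := Metric.isOpen_ball.is_const_of_deriv_eq_zero
    (convex_ball a ε).isPreconnected
    (fun x hx => (hderiv x hx).differentiableAt.differentiableWithinAt)
    (fun x hx => (hderiv x hx).deriv) hmem (Metric.mem_ball_self hε)
  simp only [hva, zero_div, div_eq_zero_iff, hball _ hmem, or_false] at hconst
  exact hK v hv a (a + ε / 2) (by linarith) hva hconst t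

/-- Without conjugate points, the values of solutions vanishing at `a` are proportional to
their derivatives at `a`. -/
lemma mul_deriv_eq_mul_deriv (hK : WithoutConjugatePoints K) (hu : IsJacobiSolution K u)
    (hv : IsJacobiSolution K v) {a : ℝ} (hua : u a = 0) (hva : v a = 0) (t : ℝ) :
    u t * deriv v a = v t * deriv u a := by
  rcases eq_or_ne a t with rfl | hat
  · rw [hua, hva, zero_mul, zero_mul]
  have h0 := hK _ (hu.linear_comb hv (v t) (-u t)) a t hat (by simp [hua, hva]) (by ring)
  have h1 := congrFun (hu.deriv_linear_comb hv (v t) (-u t)) a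
  rw [funext h0, deriv_const] at h1
  linarith

end IsJacobiSolution

theorem stmt_9 (K : ℝ → ℝ) (hK : Continuous K)
    (hwcp : WithoutConjugatePoints K)
    (J : ℝ → ℝ → ℝ)
    (hJ : ∀ r : ℝ, 0 < r →
      IsJacobiSolution K (J r) ∧ J r 0 = 1 ∧ J r r = 0)
    (Jinf : ℝ → ℝ) (hJinf : IsJacobiSolution K Jinf) (hJinf0 : Jinf 0 = 1)
    (hJinf0' : Tendsto (fun r => deriv (J r) 0) atTop (nhds (deriv Jinf 0))) :
    ∀ t : ℝ, Tendsto (fun r => J r t) atTop (nhds (Jinf t)) := by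
  intro t
  set D : ℝ → ℝ → ℝ := fun r x => 1 * J r x + (-1) * Jinf x with hD
  have hsol (r : ℝ) (hr : 0 < r) : IsJacobiSolution K (D r) :=
    (hJ r hr).1.linear_comb hJinf 1 (-1)
  have hzero (r : ℝ) (hr : 0 < r) : D r 0 = 0 := by simp [hD, (hJ r hr).2.1, hJinf0]
  suffices h : Tendsto (fun r => D r t) atTop (nhds 0) by
    simpa [hD] using h.add_const (Jinf t)
  by_cases hs : ∃ s, 0 < s ∧ deriv (D s) 0 ≠ 0
  · obtain ⟨s, hs, hs'⟩ := hs
    have hlim : Tendsto (fun r => D s t / deriv (D s) 0 * (deriv (J r) 0 - deriv Jinf 0)) atTop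
        (nhds 0) := by
      simpa using (hJinf0'.sub_const (deriv Jinf 0)).const_mul (D s t / deriv (D s) 0)
    refine hlim.congr' ?_
    filter_upwards [eventually_gt_atTop 0] with r hr
    have h := (hsol r hr).mul_deriv_eq_mul_deriv hwcp (hsol s hs) (hzero r hr) (hzero s hs) t
    have hd : deriv (D r) 0 = deriv (J r) 0 - deriv Jinf 0 := by
      rw [congrFun ((hJ r hr).1.deriv_linear_comb hJinf 1 (-1)) 0]
      ring
    rw [← hd, div_mul_eq_mul_div, ← h, mul_div_cancel_right₀ _ hs']
  · push Not at hs
    refine tendsto_const_nhds.congr' ?_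
    filter_upwards [eventually_gt_atTop 0] with r hr
    exact (hJinf.eq_zero_of_deriv_eq_zero hwcp (hsol r hr) (by simp [hJinf0]) (hzero r hr)
      (hs r hr) t).symm
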